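/- arXiv:1705.05758 — 2 statements merged into one kernel-verified Lean document; each statement's English description precedes it below -/
import Mathlib

section
/- For every integer n ≥ 6, the distinguishing index of the cycle C_n on n vertices equals 2. -/
/-- An edge labeling `f` of `G` with values in `Fin d` is *distinguishing* if the identity is the
only automorphism of `G` preserving it. -/
def SimpleGraph.IsDistinguishingEdgeLabeling {V : Type*} (G : SimpleGraph V) {d : ℕ}
    (f : G.edgeSet → Fin d) : Prop :=
  ∀ φ : G ≃g G, (∀ e : G.edgeSet, f (φ.mapEdgeSet e) = f e) → ∀ v : V, φ v = v

/-- The distinguishing index `D'(G)`: the least number of labels in a distinguishing edge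
labeling of `G`. -/
noncomputable def SimpleGraph.distinguishingIndex {V : Type*} (G : SimpleGraph V) : ℕ :=
  sInf {d : ℕ | ∃ f : G.edgeSet → Fin d, G.IsDistinguishingEdgeLabeling f}

namespace SimpleGraph

/-- Adjacency in a cycle graph, in terms of the underlying natural numbers. -/
theorem cycleGraph_adj_iff_val {n : ℕ} (hn : 2 ≤ n) (u v : Fin n) :
    (cycleGraph n).Adj u v ↔ u.val + 1 = v.val ∨ v.val + 1 = u.val ∨
      (u.val = 0 ∧ v.val + 1 = n) ∨ (v.val = 0 ∧ u.val + 1 = n) := by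
  have hu := u.isLt
  have hv := v.isLt
  rw [cycleGraph_adj', Fin.sub_def, Fin.sub_def]
  dsimp only
  have key : ∀ a b : ℕ, a < n → b < n →
      ((n - b + a) % n = 1 ↔ a = b + 1 ∨ (a = 0 ∧ b + 1 = n)) := by
    intro a b ha hb
    rcases le_or_gt b a with h | h
    · rw [show n - b + a = a - b + n by omega, Nat.add_mod_right, Nat.mod_eq_of_lt (by omega)]
      omega
    · rw [Nat.mod_eq_of_lt (by omega)]
      omega
  rw [key _ _ hu hv, key _ _ hv hu]
  omega

/-- The natural number pairs whose edges form the disjoint union of the paths `0 - 1 - 2` and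
`3 - 4`. -/
def IsMarkedPair (a b : ℕ) : Prop :=
  (a + 1 = b ∧ (a = 0 ∨ a = 1 ∨ a = 3)) ∨ (b + 1 = a ∧ (b = 0 ∨ b = 1 ∨ b = 3))

/-- An automorphism of a cycle on at least six vertices that preserves the marked edges
is trivial. -/
theorem cycleGraph_iso_apply_eq_of_isMarkedPair_iff {n : ℕ} (hn : 6 ≤ n)
    (φ : cycleGraph n ≃g cycleGraph n)
    (h : ∀ u v, (cycleGraph n).Adj u v →
      (IsMarkedPair (φ u).val (φ v).val ↔ IsMarkedPair u.val v.val)) (v : Fin n) :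
    φ v = v := by
  have adj_step : ∀ (i : ℕ) (hi : i + 1 < n),
      (cycleGraph n).Adj ⟨i, by omega⟩ ⟨i + 1, hi⟩ := fun i hi => by
    rw [cycleGraph_adj_iff_val (by omega)]; exact Or.inl rfl
  have image_adj : ∀ (i : ℕ) (hi : i + 1 < n), _ := fun i hi =>
    (cycleGraph_adj_iff_val (by omega) _ _).1 (φ.map_adj_iff.2 (adj_step i hi))
  have image_ne : ∀ (i j : ℕ) (hi : i < n) (hj : j < n), i ≠ j →
      (φ ⟨i, hi⟩).val ≠ (φ ⟨j, hj⟩).val := fun i j hi hj hij heq =>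
    hij (Fin.mk.inj_iff.1 (φ.injective (Fin.ext heq)))
  have marked : ∀ (i : ℕ) (hi : i + 1 < n), (i = 0 ∨ i = 1 ∨ i = 3) →
      IsMarkedPair (φ ⟨i, by omega⟩).val (φ ⟨i + 1, hi⟩).val := fun i hi h_start =>
    (h _ _ (adj_step i hi)).2 (Or.inl ⟨rfl, h_start⟩)
  simp only [IsMarkedPair] at marked
  have fixed_one_two : (φ ⟨1, by omega⟩).val = 1 ∧ (φ ⟨2, by omega⟩).val = 2 := by
    have m0 := marked 0 (by omega) (by omega)
    have m1 := marked 1 (by omega) (by omega)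
    have m3 := marked 3 (by omega) (by omega)
    have a2 := image_adj 2 (by omega)
    have n02 := image_ne 0 2 (by omega) (by omega) (by omega)
    have n13 := image_ne 1 3 (by omega) (by omega) (by omega)
    simp only [Nat.reduceAdd] at m0 m1 m3 a2
    omega
  have fixed_succ : ∀ (i : ℕ) (hi : i + 2 < n), (φ ⟨i + 1, by omega⟩).val = i + 1 ∧
      (φ ⟨i + 2, hi⟩).val = i + 2 := by
    intro i
    induction i with
    | zero => exact fun _ => fixed_one_two
    | succ i ih =>
      intro hi
      obtain ⟨ih₁, ih₂⟩ := ih (by omega)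
      refine ⟨ih₂, ?_⟩
      have a := image_adj (i + 2) hi
      have hne := image_ne (i + 1) (i + 3) (by omega) hi (by omega)
      change _ ≠ (φ ⟨i + 2 + 1, hi⟩).val at hne
      change (φ ⟨i + 2 + 1, hi⟩).val = _
      omega
  obtain ⟨v, hv⟩ := v
  apply Fin.ext
  match v with
  | 0 =>
    have m0 := marked 0 (by omega) (by omega)
    have hne := image_ne 0 2 (by omega) (by omega) (by omega)
    simp only [Nat.reduceAdd] at m0
    change (φ ⟨0, hv⟩).val = 0
    omega
  | 1 => exact fixed_one_two.1
  | i + 2 => exact (fixed_succ i hv).2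

/-- A cycle on at least six vertices has a distinguishing edge labeling with two labels. -/
theorem exists_isDistinguishingEdgeLabeling_cycleGraph {n : ℕ} (hn : 6 ≤ n) :
    ∃ f : (cycleGraph n).edgeSet → Fin 2, (cycleGraph n).IsDistinguishingEdgeLabeling f := by
  classical
  let marked : Sym2 (Fin n) → Prop := Sym2.lift ⟨fun u v => IsMarkedPair u.val v.val,
    fun _ _ => propext Or.comm⟩
  refine ⟨fun e => if marked e.1 then 1 else 0, fun φ hφ => ?_⟩
  refine cycleGraph_iso_apply_eq_of_isMarkedPair_iff hn φ fun u v huv => ?_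
  have hpres := hφ ⟨s(u, v), huv⟩
  change (if IsMarkedPair (φ u).val (φ v).val then (1 : Fin 2) else 0) =
    (if IsMarkedPair u.val v.val then 1 else 0) at hpres
  split_ifs at hpres <;> simp_all

/-- The rotation of a cycle graph by one step. -/
def cycleGraphRotation (n : ℕ) [NeZero n] : cycleGraph n ≃g cycleGraph n where
  toEquiv := Equiv.addRight 1
  map_rel_iff' := by
    intro u v
    simp [cycleGraph_adj']

/-- A distinguishing edge labeling of a cycle on at least two vertices uses at least two labels. -/
theorem IsDistinguishingEdgeLabeling.two_le_of_cycleGraph {n d : ℕ} (hn : 2 ≤ n)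
    {f : (cycleGraph n).edgeSet → Fin d}
    (hf : (cycleGraph n).IsDistinguishingEdgeLabeling f) : 2 ≤ d := by
  by_contra hd
  have : NeZero n := ⟨by omega⟩
  have : Subsingleton (Fin d) := Fin.subsingleton_iff_le_one.2 (by omega)
  have hrot : (0 : Fin n) + 1 = 0 :=
    hf (cycleGraphRotation n) (fun _ => Subsingleton.elim _ _) 0
  have hval := congrArg Fin.val hrot
  rw [zero_add, Fin.val_one', Nat.mod_eq_of_lt (by omega)] at hval
  simp at hval

end SimpleGraph

theorem distinguishingIndex_cycleGraph_of_six_le (n : ℕ) (hn : 6 ≤ n) :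
    (SimpleGraph.cycleGraph n).distinguishingIndex = 2 := by
  have hmem := SimpleGraph.exists_isDistinguishingEdgeLabeling_cycleGraph hn
  refine le_antisymm (Nat.sInf_le hmem) (le_csInf ⟨2, hmem⟩ ?_)
  rintro d ⟨f, hf⟩
  exact hf.two_le_of_cycleGraph (by omega)
end

section
/- Let G be a finite connected simple graph of order n ≥ 3 with maximum degree Δ. Then D'(G) > Δ if and only if G is isomorphic to a cycle of length at most 5 (i.e. to C₃, C₄ or C₅), and in that case D'(G) = Δ + 1 = 3. -/
namespace SimpleGraph

variable {V : Type*} {G : SimpleGraph V}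

/-- The automorphism `φ` of `G` preserves the restriction to the edges of `G` of the labeling `f`
of all unordered pairs. -/
def PreservesLabels {L : Type*} (f : Sym2 V → L) (φ : G ≃g G) : Prop :=
  ∀ ⦃a b : V⦄, G.Adj a b → f s(φ a, φ b) = f s(a, b)

theorem distinguishingIndex_le_of_forall_preservesLabels {d : ℕ} (f : Sym2 V → Fin d)
    (hf : ∀ φ : G ≃g G, PreservesLabels f φ → ∀ v, φ v = v) : G.distinguishingIndex ≤ d := by
  refine Nat.sInf_le ⟨fun e => f e, fun φ hφ => hf φ fun a b hab => ?_⟩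
  exact hφ ⟨s(a, b), hab⟩

/-- The labels of all pairs containing a given element may be prescribed freely. -/
theorem exists_relabel_star {L : Type*} (g : Sym2 V → L) (x : V) (p : V → L) :
    ∃ g' : Sym2 V → L, (∀ w, g' s(x, w) = p w) ∧
      ∀ a b, a ≠ x → b ≠ x → g' s(a, b) = g s(a, b) := by
  classical
  refine ⟨fun e => if h : ∃ w, e = s(x, w) then p h.choose else g e, fun w => ?_, ?_⟩
  · have h : ∃ w', s(x, w) = s(x, w') := ⟨w, rfl⟩
    have hw : h.choose = w := (Sym2.congr_right.mp h.choose_spec).symm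
    simp only [dif_pos h, hw]
  · intro a b ha hb
    refine dif_neg ?_
    rintro ⟨w, hw⟩
    grind [Sym2.eq_iff]

theorem _root_.Finset.exists_injOn_fin_map_eq_zero {m : ℕ} (A : Finset V)
    (hA : A.card ≤ m + 1) (a : V) :
    ∃ α : V → Fin (m + 1), Set.InjOn α A ∧ α a = 0 := by
  classical
  obtain ⟨e⟩ : Nonempty (A ↪ Fin (m + 1)) :=
    Function.Embedding.nonempty_of_card_le (by simpa using hA)
  let α : V → Fin (m + 1) := fun v => if h : v ∈ A then e ⟨v, h⟩ else 0
  refine ⟨fun v => Equiv.swap (α a) 0 (α v), fun v hv w hw h => ?_, by simp⟩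
  have h' : α v = α w := (Equiv.swap (α a) 0).injective h
  have hv' : v ∈ A := hv
  have hw' : w ∈ A := hw
  simpa [α, hv', hw'] using h'

theorem Connected.exists_adj_mem_notMem (hG : G.Connected) {S : Finset V} (hS : S.Nonempty)
    {v : V} (hv : v ∉ S) : ∃ a ∈ S, ∃ b ∉ S, G.Adj a b := by
  obtain ⟨u, hu⟩ := hS
  obtain ⟨p⟩ := hG.preconnected u v
  obtain ⟨d, -, h1, h2⟩ := p.exists_boundary_dart (S : Set V) hu hv
  exact ⟨d.fst, h1, d.snd, h2, d.adj⟩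

/-- A labeling of the pairs inside a set `S` of vertices, each with a neighbor in `S`, extends to
a labeling that is nonzero on the remaining edges and for which only the identity preserves labels
and fixes `S` pointwise. -/
theorem Connected.exists_extend_labeling [Fintype V] [DecidableRel G.Adj] (hG : G.Connected)
    {m : ℕ} (hdeg : ∀ v, G.degree v ≤ m + 2) (S : Finset V) (hS : S.Nonempty)
    (hSadj : ∀ a ∈ S, ∃ b ∈ S, G.Adj a b) (g : Sym2 V → Fin (m + 2)) :
    ∃ f : Sym2 V → Fin (m + 2), (∀ a ∈ S, ∀ b ∈ S, f s(a, b) = g s(a, b)) ∧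
      (∀ a b, G.Adj a b → f s(a, b) = 0 → a ∈ S ∧ b ∈ S) ∧
      ∀ φ : G ≃g G, PreservesLabels f φ → (∀ v ∈ S, φ v = v) → ∀ v, φ v = v := by
  classical
  induction hn : Fintype.card V - S.card using Nat.strong_induction_on generalizing S g with
  | _ n ih =>
  by_cases hall : ∀ v, v ∈ S
  · exact ⟨g, fun _ _ _ _ => rfl, fun a b _ _ => ⟨hall a, hall b⟩, fun φ _ h v => h v (hall v)⟩
  push Not at hall
  obtain ⟨v, hv⟩ := hall
  obtain ⟨u, huS, t, htS, hut⟩ := hG.exists_adj_mem_notMem hS hv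
  have hN : (G.neighborFinset u \ S).card ≤ m + 1 := by
    obtain ⟨b, hbS, hub⟩ := hSadj u huS
    have hlt : (G.neighborFinset u \ S).card < (G.neighborFinset u).card :=
      Finset.card_lt_card ⟨Finset.sdiff_subset, fun h => by
        have := h ((G.mem_neighborFinset u b).2 hub)
        simp [hbS] at this⟩
    have := hdeg u
    rw [card_neighborFinset_eq_degree] at hlt
    omega
  obtain ⟨ι, hι, -⟩ := Finset.exists_injOn_fin_map_eq_zero _ hN u
  obtain ⟨g', hg'u, hg'⟩ := exists_relabel_star
    (fun e => if ∀ v ∈ e, v ∈ S then g e else 1) u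
    (fun w => if w ∈ S then g s(u, w) else (ι w).succ)
  have hg'S : ∀ a ∈ S, ∀ b ∈ S, g' s(a, b) = g s(a, b) := by
    intro a ha b hb
    by_cases hau : a = u
    · subst hau; rw [hg'u, if_pos hb]
    by_cases hbu : b = u
    · subst hbu; rw [Sym2.eq_swap, hg'u, if_pos ha]
    rw [hg' a b hau hbu, if_pos]
    simp [ha, hb]
  have hg'0 : ∀ a b, g' s(a, b) = 0 → a ∈ S ∧ b ∈ S := by
    intro a b h
    by_cases hau : a = u
    · subst hau
      rw [hg'u] at h
      by_contra hb
      rw [if_neg (by tauto)] at h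
      exact Fin.succ_ne_zero _ h
    by_cases hbu : b = u
    · subst hbu
      rw [Sym2.eq_swap, hg'u] at h
      by_contra hb
      rw [if_neg (by tauto)] at h
      exact Fin.succ_ne_zero _ h
    rw [hg' a b hau hbu] at h
    by_contra hb
    rw [if_neg (by simpa using hb)] at h
    exact one_ne_zero h
  have hcard : S.card < (S ∪ G.neighborFinset u).card :=
    Finset.card_lt_card ⟨Finset.subset_union_left, fun h => htS (h (by simp [hut]))⟩
  have hle := Finset.card_le_univ (S ∪ G.neighborFinset u)
  obtain ⟨f, hfg, hf0, hf⟩ := ih _ (by omega) (S ∪ G.neighborFinset u)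
    (hS.mono Finset.subset_union_left) (by
      intro a ha
      rcases Finset.mem_union.1 ha with ha | ha
      · obtain ⟨b, hb, hab⟩ := hSadj a ha
        exact ⟨b, Finset.mem_union_left _ hb, hab⟩
      · exact ⟨u, Finset.mem_union_left _ huS, ((G.mem_neighborFinset u a).1 ha).symm⟩) g' rfl
  refine ⟨f, fun a ha b hb => ?_, fun a b hab h => ?_, fun φ hφ hfix => hf φ hφ fun w hw => ?_⟩
  · rw [hfg a (Finset.mem_union_left _ ha) b (Finset.mem_union_left _ hb), hg'S a ha b hb]
  · obtain ⟨ha, hb⟩ := hf0 a b hab h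
    exact hg'0 a b (hfg a ha b hb ▸ h)
  · by_cases hwS : w ∈ S
    · exact hfix w hwS
    have huw : G.Adj u w := by simpa [hwS] using hw
    have huφw : G.Adj u (φ w) := by simpa [hfix u huS] using φ.map_adj_iff.2 huw
    have hφwS : φ w ∉ S := fun h => hwS (φ.injective (hfix _ h) ▸ h)
    have hlabel := hφ huw
    have hu' : u ∈ S ∪ G.neighborFinset u := Finset.mem_union_left _ huS
    rw [hfix u huS, hfg u hu' _ (by simp [huφw]), hfg u hu' w hw, hg'u, hg'u, if_neg hwS,
      if_neg hφwS] at hlabel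
    exact hι (by simp [huφw, hφwS]) (by simp [huw, hwS]) (Fin.succ_injective _ hlabel)

theorem Connected.distinguishingIndex_le_of_degree_ne [Fintype V] [DecidableRel G.Adj]
    (hG : G.Connected) {m : ℕ} (hdeg : ∀ v, G.degree v ≤ m + 2) {x y : V} (hxy : G.Adj x y)
    (hne : G.degree x ≠ G.degree y) : G.distinguishingIndex ≤ m + 2 := by
  classical
  obtain ⟨f, hfg, hf0, hf⟩ := hG.exists_extend_labeling hdeg {x, y} (by simp)
    (by simp [hxy, hxy.symm]) (fun _ => 0)
  refine distinguishingIndex_le_of_forall_preservesLabels f fun φ hφ => hf φ hφ ?_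
  have h0 : f s(φ x, φ y) = 0 := by rw [hφ hxy, hfg x (by simp) y (by simp)]
  obtain ⟨h1, h2⟩ := hf0 _ _ (φ.map_adj_iff.2 hxy) h0
  have hx : φ x ≠ y := fun h => hne (by rw [← φ.degree_eq x, h])
  have hy : φ y ≠ x := fun h => hne (by rw [← φ.degree_eq y, h])
  simp_all

theorem Connected.distinguishingIndex_le_of_isRegularOfDegree [Fintype V] [DecidableRel G.Adj]
    (hG : G.Connected) {m : ℕ} (hreg : G.IsRegularOfDegree (m + 3)) :
    G.distinguishingIndex ≤ m + 3 := by
  classical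
  obtain ⟨x⟩ := hG.nonempty
  have hex : ∀ (v : V) (A : Finset V), A.card < m + 3 → ∃ w, G.Adj v w ∧ w ∉ A := by
    intro v A hA
    obtain ⟨w, hw, hwA⟩ := Finset.exists_mem_notMem_of_card_lt_card
      (s := A) (t := G.neighborFinset v) (by rwa [card_neighborFinset_eq_degree, hreg v])
    exact ⟨w, by simpa using hw, hwA⟩
  obtain ⟨y, hxy, -⟩ := hex x ∅ (by simp)
  obtain ⟨r, hxr, hry⟩ := hex x {y} (by simp)
  obtain ⟨z, hyz, hz⟩ := hex y {x, r} (Finset.card_le_two.trans_lt (by omega))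
  simp only [Finset.mem_insert, Finset.mem_singleton, not_or] at hry hz
  obtain ⟨hzx, hzr⟩ := hz
  have hcard : ∀ a b, G.Adj a b → ((G.neighborFinset a).erase b).card = m + 2 := by
    intro a b hab
    rw [Finset.card_erase_of_mem (by simpa using hab), card_neighborFinset_eq_degree, hreg a]
    rfl
  obtain ⟨α, hα, hαr⟩ :=
    Finset.exists_injOn_fin_map_eq_zero (m := m + 1) _ (hcard x y hxy).le r
  obtain ⟨β, hβ, hβz⟩ :=
    Finset.exists_injOn_fin_map_eq_zero (m := m + 1) _ (hcard y x hxy.symm).le z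
  -- The zero labels form the path `r x y z`; the label `1` occurs at `y` but not at `x`.
  obtain ⟨g₁, hg₁y, hg₁⟩ := exists_relabel_star (fun _ => (1 : Fin (m + 3))) y
    (fun w => (β w).castSucc)
  obtain ⟨g, hgx, hg⟩ := exists_relabel_star g₁ x
    (fun w => if w = y then 0 else (1 : Fin (m + 3)).succAbove (α w))
  have hgy : ∀ w, w ≠ x → g s(y, w) = (β w).castSucc := fun w hw => by
    rw [hg y w hxy.ne' hw, hg₁y]
  have hg1 : ∀ a b, a ≠ x → a ≠ y → b ≠ x → b ≠ y → g s(a, b) = 1 := by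
    intro a b h1 h2 h3 h4
    rw [hg a b h1 h3, hg₁ a b h2 h4]
  have hxS : x ∈ G.neighborFinset x ∪ G.neighborFinset y := by simp [hxy.symm]
  have hyS : y ∈ G.neighborFinset x ∪ G.neighborFinset y := by simp [hxy]
  obtain ⟨f, hfg, hf0, hf⟩ := hG.exists_extend_labeling (m := m + 1) (fun v => (hreg v).le)
    (G.neighborFinset x ∪ G.neighborFinset y) ⟨x, hxS⟩ (by
      intro a ha
      rcases Finset.mem_union.1 ha with ha | ha
      · exact ⟨x, hxS, ((G.mem_neighborFinset x a).1 ha).symm⟩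
      · exact ⟨y, hyS, ((G.mem_neighborFinset y a).1 ha).symm⟩) g
  have hfx : ∀ w, G.Adj x w → f s(x, w) = g s(x, w) := fun w hw =>
    hfg x hxS w (by simp [hw])
  have hfy : ∀ w, G.Adj y w → f s(y, w) = g s(y, w) := fun w hw =>
    hfg y hyS w (by simp [hw])
  have hsA : (1 : Fin (m + 3)).succAbove (0 : Fin (m + 2)) = 0 := by
    rw [Fin.succAbove_of_castSucc_lt] <;> simp
  have hfxy : f s(x, y) = 0 := by rw [hfx y hxy, hgx, if_pos rfl]
  have hfxr : f s(x, r) = 0 := by rw [hfx r hxr, hgx, if_neg hry, hαr, hsA]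
  have hfyz : f s(y, z) = 0 := by rw [hfy z hyz, hgy z hzx, hβz, Fin.castSucc_zero]
  have hxzero : ∀ w, G.Adj x w → f s(x, w) = 0 → w ≠ y → w = r := by
    intro w hw h hwy
    rw [hfx w hw, hgx, if_neg hwy, ← hsA] at h
    refine hα (by simp [hw, hwy]) (by simp [hxr, hry]) ?_
    rw [hαr]
    exact Fin.succAbove_right_injective h
  have hyzero : ∀ w, G.Adj y w → f s(y, w) = 0 → w ≠ x → w = z := by
    intro w hw h hwx
    rw [hfy w hw, hgy w hwx] at h
    refine hβ (by simp [hw, hwx]) (by simp [hyz, hzx]) ?_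
    rw [hβz]
    exact Fin.castSucc_injective _ (h.trans Fin.castSucc_zero.symm)
  have hzero : ∀ u a, G.Adj u a → f s(u, a) = 0 → u ≠ x → u ≠ y →
      (a = x ∧ u = r) ∨ (a = y ∧ u = z) := by
    intro u a hua h hux huy
    obtain ⟨hu, ha⟩ := hf0 u a hua h
    by_cases hax : a = x
    · subst hax
      exact Or.inl ⟨rfl, hxzero u hua.symm (Sym2.eq_swap ▸ h) huy⟩
    by_cases hay : a = y
    · subst hay
      exact Or.inr ⟨rfl, hyzero u hua.symm (Sym2.eq_swap ▸ h) hux⟩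
    rw [hfg u hu a ha, hg1 u a hux huy hax hay] at h
    exact absurd h one_ne_zero
  have hcenter : ∀ u a b, G.Adj u a → G.Adj u b → a ≠ b → f s(u, a) = 0 → f s(u, b) = 0 →
      u = x ∨ u = y := by
    intro u a b hua hub hab ha hb
    by_contra hu
    push Not at hu
    have h1 := hzero u a hua ha hu.1 hu.2
    have h2 := hzero u b hub hb hu.1 hu.2
    grind
  refine distinguishingIndex_le_of_forall_preservesLabels f fun φ hφ => hf φ hφ ?_
  have hadj : ∀ {a b}, G.Adj a b → G.Adj (φ a) (φ b) := fun h => φ.map_adj_iff.2 h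
  have hφx : φ x = x ∨ φ x = y := hcenter (φ x) (φ r) (φ y) (hadj hxr) (hadj hxy)
    (φ.injective.ne hry) (by rw [hφ hxr, hfxr]) (by rw [hφ hxy, hfxy])
  have hφy : φ y = x ∨ φ y = y := hcenter (φ y) (φ x) (φ z) (hadj hxy.symm) (hadj hyz)
    (φ.injective.ne (Ne.symm hzx)) (by rw [hφ hxy.symm, Sym2.eq_swap, hfxy])
    (by rw [hφ hyz, hfyz])
  have hφyx : φ y ≠ x := by
    intro h
    obtain ⟨w, hw, hβw⟩ := Finset.surjOn_of_injOn_of_card_le (t := Finset.univ) β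
      (fun _ _ => Finset.mem_coe.2 (Finset.mem_univ _)) hβ
      (by rw [hcard y x hxy.symm]; simp) (Finset.mem_coe.2 (Finset.mem_univ 1))
    simp only [Finset.coe_erase, coe_neighborFinset, Set.mem_sdiff, mem_neighborSet,
      Set.mem_singleton_iff] at hw
    have hxw : G.Adj x (φ w) := h ▸ hadj hw.1
    have hlabel := hφ hw.1
    rw [h, hfx _ hxw, hfy w hw.1, hgx, hgy w hw.2, hβw] at hlabel
    split_ifs at hlabel
    · exact absurd hlabel (by simp)
    · exact Fin.succAbove_ne _ _ (hlabel.trans (by simp))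
  have hy : φ y = y := hφy.resolve_left hφyx
  have hx : φ x = x := hφx.resolve_right fun h => hxy.ne (φ.injective (h.trans hy.symm))
  intro w hw
  by_cases hwx : w = x
  · rw [hwx, hx]
  by_cases hwy : w = y
  · rw [hwy, hy]
  have hφwx : φ w ≠ x := fun h => hwx (φ.injective (h.trans hx.symm))
  have hφwy : φ w ≠ y := fun h => hwy (φ.injective (h.trans hy.symm))
  simp only [Finset.mem_union, mem_neighborFinset] at hw
  rcases hw with hw | hw
  · have hw' : G.Adj x (φ w) := by simpa [hx] using hadj hw
    have hlabel := hφ hw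
    rw [hx, hfx _ hw', hfx _ hw, hgx, hgx, if_neg hwy, if_neg hφwy] at hlabel
    exact hα (by simp [hw', hφwy]) (by simp [hw, hwy]) (Fin.succAbove_right_injective hlabel)
  · have hw' : G.Adj y (φ w) := by simpa [hy] using hadj hw
    have hlabel := hφ hw
    rw [hy, hfy _ hw', hfy _ hw, hgy _ hφwx, hgy _ hwx] at hlabel
    exact hβ (by simp [hw', hφwx]) (by simp [hw, hwx]) (Fin.castSucc_injective _ hlabel)

theorem Connected.nonempty_iso_of_injective_of_degree_le {W : Type*} [Fintype W] [Nonempty W]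
    {H : SimpleGraph W} [DecidableRel H.Adj] [Fintype V] [DecidableRel G.Adj] (hG : G.Connected)
    (c : H →g G) (hc : Function.Injective c) (hdeg : ∀ w, G.degree (c w) ≤ H.degree w) :
    Nonempty (G ≃g H) := by
  classical
  have hN : ∀ w, (H.neighborFinset w).image c = G.neighborFinset (c w) := fun w =>
    Finset.eq_of_subset_of_card_le
      (fun v hv => by
        obtain ⟨u, hu, rfl⟩ := Finset.mem_image.1 hv
        simpa using c.map_adj ((H.mem_neighborFinset w u).1 hu))
      (by simpa [Finset.card_image_of_injective _ hc] using hdeg w)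
  have hsurj : Function.Surjective c := by
    intro v
    by_contra hv
    obtain ⟨a, ha, b, hb, hab⟩ := hG.exists_adj_mem_notMem
      (S := Finset.univ.image c) (Finset.univ_nonempty.image c) (v := v) (by simpa using hv)
    obtain ⟨w, -, rfl⟩ := Finset.mem_image.1 ha
    rw [← mem_neighborFinset, ← hN] at hab
    obtain ⟨u, -, rfl⟩ := Finset.mem_image.1 hab
    simp at hb
  refine ⟨RelIso.symm ⟨Equiv.ofBijective c ⟨hc, hsurj⟩, fun {a b} => ⟨fun h => ?_, c.map_adj⟩⟩⟩
  have hb : c b ∈ G.neighborFinset (c a) := (G.mem_neighborFinset _ _).2 h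
  rw [← hN] at hb
  obtain ⟨u, hu, hub⟩ := Finset.mem_image.1 hb
  simpa [hc hub] using hu

theorem Connected.nonempty_iso_cycleGraph [Fintype V] [DecidableRel G.Adj] (hG : G.Connected)
    (hreg : G.IsRegularOfDegree 2) {n : ℕ} (c : Fin (n + 3) → V) (hc : Function.Injective c)
    (hadj : ∀ i, G.Adj (c i) (c (i + 1))) : Nonempty (G ≃g cycleGraph (n + 3)) := by
  refine hG.nonempty_iso_of_injective_of_degree_le (H := cycleGraph (n + 3)) ⟨c, ?_⟩ hc
    fun w => by rw [hreg, cycleGraph_degree_three_le]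
  intro a b hab
  rcases cycleGraph_adj.1 hab with h | h
  · rw [sub_eq_iff_eq_add'.1 h]
    exact (hadj b).symm
  · rw [sub_eq_iff_eq_add'.1 h]
    exact hadj a

theorem IsRegularOfDegree.exists_adj_iff [Fintype V] [DecidableRel G.Adj]
    (hreg : G.IsRegularOfDegree 2) {v a : V} (ha : G.Adj v a) :
    ∃ b, b ≠ a ∧ ∀ w, G.Adj v w ↔ w = a ∨ w = b := by
  classical
  have h2 : (G.neighborFinset v).card = 2 := by rw [card_neighborFinset_eq_degree, hreg v]
  obtain ⟨p, q, hpq, hN⟩ := Finset.card_eq_two.1 h2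
  have hiff : ∀ w, G.Adj v w ↔ w = p ∨ w = q := fun w => by
    rw [← mem_neighborFinset, hN]; simp
  rcases (hiff a).1 ha with rfl | rfl
  · exact ⟨q, hpq.symm, hiff⟩
  · exact ⟨p, hpq, fun w => (hiff w).trans or_comm⟩

theorem Connected.distinguishingIndex_le_two_or_nonempty_iso_cycleGraph [Fintype V]
    [DecidableRel G.Adj] (hG : G.Connected) (hreg : G.IsRegularOfDegree 2) :
    G.distinguishingIndex ≤ 2 ∨ Nonempty (G ≃g cycleGraph 3) ∨ Nonempty (G ≃g cycleGraph 4) ∨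
      Nonempty (G ≃g cycleGraph 5) := by
  classical
  obtain ⟨v₁⟩ := hG.nonempty
  obtain ⟨v₀, h10⟩ : ∃ w, G.Adj v₁ w :=
    (G.degree_pos_iff_exists_adj v₁).1 (by rw [hreg v₁]; norm_num)
  obtain ⟨v₂, h02, hN1⟩ := hreg.exists_adj_iff h10
  have h12 : G.Adj v₁ v₂ := (hN1 v₂).2 (Or.inr rfl)
  obtain ⟨v₃, h13, hN2⟩ := hreg.exists_adj_iff h12.symm
  have h23 : G.Adj v₂ v₃ := (hN2 v₃).2 (Or.inr rfl)
  by_cases h03 : v₃ = v₀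
  · subst h03
    refine Or.inr (Or.inl (hG.nonempty_iso_cycleGraph (n := 0) hreg ![v₃, v₁, v₂] ?_ ?_))
    · intro i j hij
      fin_cases i <;> fin_cases j <;> simp_all [h10.ne, h10.ne', h12.ne, h12.ne', Ne.symm h02]
    · intro i
      fin_cases i
      · exact h10.symm
      · exact h12
      · exact h23
  obtain ⟨v₄, h24, hN3⟩ := hreg.exists_adj_iff h23.symm
  have h34 : G.Adj v₃ v₄ := (hN3 v₄).2 (Or.inr rfl)
  have h14 : v₄ ≠ v₁ := by
    rintro rfl
    rcases (hN1 v₃).1 h34.symm with h | h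
    · exact h03 h
    · exact h23.ne h.symm
  by_cases h04 : v₄ = v₀
  · subst h04
    refine Or.inr (Or.inr (Or.inl
      (hG.nonempty_iso_cycleGraph (n := 1) hreg ![v₄, v₁, v₂, v₃] ?_ ?_)))
    · have hd := h10.ne
      have hd' := h12.ne
      have hd'' := h23.ne
      have hd''' := h34.ne
      intro i j hij
      fin_cases i <;> fin_cases j <;> simp at hij ⊢ <;> grind
    · intro i
      fin_cases i
      · exact h10.symm
      · exact h12
      · exact h23
      · exact h34
  have d01 := h10.ne
  have d12 := h12.ne
  have d23 := h23.ne
  have d34 := h34.ne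
  by_cases h40 : G.Adj v₄ v₀
  · refine Or.inr (Or.inr (Or.inr
      (hG.nonempty_iso_cycleGraph (n := 2) hreg ![v₀, v₁, v₂, v₃, v₄] ?_ ?_)))
    · intro i j hij
      fin_cases i <;> fin_cases j <;> simp at hij ⊢ <;> grind
    · intro i
      fin_cases i
      · exact h10.symm
      · exact h12
      · exact h23
      · exact h34
      · exact h40
  left
  -- The zero labels form the paths `v₀ v₁ v₂` and `v₃ v₄`.
  obtain ⟨f, hfg, hf0, hf⟩ := hG.exists_extend_labeling (m := 0) (fun v => (hreg v).le)
    {v₀, v₁, v₂, v₃, v₄} (by simp)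
    (by simp [h10, h10.symm, h12, h23, h34, h34.symm])
    (fun e => if e = s(v₀, v₁) ∨ e = s(v₁, v₂) ∨ e = s(v₃, v₄) then 0 else 1)
  have hzero : ∀ a b, G.Adj a b → f s(a, b) = 0 →
      s(a, b) = s(v₀, v₁) ∨ s(a, b) = s(v₁, v₂) ∨ s(a, b) = s(v₃, v₄) := by
    intro a b hab h
    obtain ⟨ha, hb⟩ := hf0 a b hab h
    rw [hfg a ha b hb] at h
    by_contra hcon
    rw [if_neg hcon] at h
    exact one_ne_zero h
  refine distinguishingIndex_le_of_forall_preservesLabels f fun φ hφ => hf φ hφ ?_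
  have hadj : ∀ {a b}, G.Adj a b → G.Adj (φ a) (φ b) := fun h => φ.map_adj_iff.2 h
  have z01 := hzero _ _ (hadj h10.symm) (by rw [hφ h10.symm, hfg _ (by simp) _ (by simp)]; simp)
  have z12 := hzero _ _ (hadj h12) (by rw [hφ h12, hfg _ (by simp) _ (by simp)]; simp)
  have z34 := hzero _ _ (hadj h34) (by rw [hφ h34, hfg _ (by simp) _ (by simp)]; simp)
  have a23 := hadj h23
  have i02 := φ.injective.ne h02
  have i13 := φ.injective.ne h13
  have i24 := φ.injective.ne h24
  have i14 := φ.injective.ne h14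
  have i03 := φ.injective.ne h03
  have i04 := φ.injective.ne h04
  have n30 : ¬ G.Adj v₀ v₃ := fun h => by
    rcases (hN3 v₀).1 h.symm with h | h
    · exact h02 h.symm
    · exact h04 h.symm
  have n24 : ¬ G.Adj v₂ v₄ := fun h => by
    rcases (hN2 v₄).1 h with h | h
    · exact h14 h
    · exact d34 h.symm
  have n40 : ¬ G.Adj v₀ v₄ := fun h => h40 h.symm
  simp only [Sym2.eq_iff] at z01 z12 z34
  have h1 : φ v₁ = v₁ := by grind
  have h3 : φ v₃ = v₃ ∨ φ v₃ = v₄ := by grind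
  have h2 : φ v₂ = v₂ ∨ φ v₂ = v₀ := by grind
  have h2' : φ v₂ = v₂ := by
    rcases h2 with h | h
    · exact h
    · rcases h3 with h' | h' <;> rw [h, h'] at a23 <;> contradiction
  have h3' : φ v₃ = v₃ := by
    rcases h3 with h | h
    · exact h
    · rw [h2', h] at a23
      contradiction
  simp only [Finset.mem_insert, Finset.mem_singleton]
  grind

theorem IsDistinguishingEdgeLabeling.comp_iso {W : Type*} {H : SimpleGraph W} {d : ℕ}
    {f : H.edgeSet → Fin d} (hf : H.IsDistinguishingEdgeLabeling f) (e : G ≃g H) :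
    G.IsDistinguishingEdgeLabeling (f ∘ e.mapEdgeSet) := by
  intro φ hφ v
  have h := hf ((e.symm.trans φ).trans e) (fun x => ?_) (e v)
  · exact e.injective (by simpa using h)
  · obtain ⟨y, rfl⟩ := e.mapEdgeSet.surjective x
    rw [← Function.comp_apply (f := f) (g := e.mapEdgeSet) (x := y), ← hφ y]
    obtain ⟨⟨a, b⟩, hy⟩ := y
    simp [Iso.mapEdgeSet, Hom.mapEdgeSet]

theorem distinguishingIndex_eq_of_iso {W : Type*} {H : SimpleGraph W} (e : G ≃g H) :
    G.distinguishingIndex = H.distinguishingIndex := by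
  unfold distinguishingIndex
  congr 1
  ext d
  exact ⟨fun ⟨_, hf⟩ => ⟨_, hf.comp_iso e.symm⟩, fun ⟨_, hf⟩ => ⟨_, hf.comp_iso e⟩⟩

/-- The reflection `i ↦ k - i` of a cycle graph. -/
def cycleGraphReflection (n : ℕ) (k : Fin (n + 2)) : cycleGraph (n + 2) ≃g cycleGraph (n + 2) where
  toEquiv := Equiv.subLeft k
  map_rel_iff' := by
    intro a b
    simp [cycleGraph_adj, or_comm]

/-- If every two-coloring of the edges of a cycle is invariant under a reflection, then the cycle
needs at least three labels. -/
theorem three_le_of_isDistinguishingEdgeLabeling_cycleGraph {n d : ℕ}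
    (hrefl : ∀ l : Fin (n + 3) → Fin 2, ∃ k, ∀ i, l (k - (i + 1)) = l i)
    (f : (cycleGraph (n + 3)).edgeSet → Fin d)
    (hf : (cycleGraph (n + 3)).IsDistinguishingEdgeLabeling f) : 3 ≤ d := by
  by_contra hd
  have hadj : ∀ i : Fin (n + 3), (cycleGraph (n + 3)).Adj i (i + 1) := fun i => by
    simp [cycleGraph_adj]
  obtain ⟨k, hk⟩ := hrefl fun i => Fin.castLE (by omega) (f ⟨s(i, i + 1), hadj i⟩)
  have hfix := hf (cycleGraphReflection (n + 1) k) (by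
    have hedge : ∀ i, f ((cycleGraphReflection (n + 1) k).mapEdgeSet ⟨s(i, i + 1), hadj i⟩) =
        f ⟨s(i, i + 1), hadj i⟩ := by
      intro i
      rw [← Fin.castLE_injective (by omega) (hk i)]
      congr 1
      apply Subtype.ext
      change s(k - i, k - (i + 1)) = s(k - (i + 1), k - (i + 1) + 1)
      rw [Sym2.eq_swap, sub_add_eq_sub_sub, sub_add_cancel]
    rintro ⟨⟨a, b⟩, hab⟩
    rcases cycleGraph_adj.1 ((mem_edgeSet _).1 hab) with h | h
    · obtain rfl : a = b + 1 := sub_eq_iff_eq_add'.1 h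
      convert hedge b using 3 <;> exact Subtype.ext Sym2.eq_swap
    · obtain rfl : b = a + 1 := sub_eq_iff_eq_add'.1 h
      exact hedge a)
  have h0 : k - 0 = 0 := hfix 0
  have h1 : k - 1 = 1 := hfix 1
  rw [sub_zero] at h0
  rw [h0, zero_sub, Fin.ext_iff] at h1
  simp [Fin.val_neg] at h1

/-- The labeling of a cycle with two consecutive edges of labels `0`, `1` and all others of
label `2`. -/
def cycleGraphLabeling (n : ℕ) (e : Sym2 (Fin (n + 3))) : Fin 3 :=
  if e = s(0, 1) then 0 else if e = s(1, 1 + 1) then 1 else 2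

theorem eq_self_of_preservesLabels_cycleGraphLabeling {n : ℕ}
    (φ : cycleGraph (n + 3) ≃g cycleGraph (n + 3))
    (hφ : PreservesLabels (cycleGraphLabeling n) φ) (i : Fin (n + 3)) : φ i = i := by
  have h01 := hφ (a := 0) (b := 1) (by simp [cycleGraph_adj])
  have h12 := hφ (a := 1) (b := 1 + 1) (by simp [cycleGraph_adj])
  have n01 : (0 : Fin (n + 3)) ≠ 1 := by simp
  have n02 : (0 : Fin (n + 3)) ≠ 1 + 1 := by
    simp [Fin.ext_iff, Fin.val_add, Nat.mod_eq_of_lt (show 2 < n + 3 by omega)]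
  have n12 : (1 : Fin (n + 3)) ≠ 1 + 1 := by simp
  simp only [cycleGraphLabeling, Sym2.eq_iff] at h01 h12
  have h1 : φ 1 = 1 := by grind
  have h0 : φ 0 = 0 := by grind
  suffices φ i = i ∧ φ (i + 1) = i + 1 from this.1
  induction i using Fin.induction with
  | zero => exact ⟨h0, by rw [zero_add, h1]⟩
  | succ j ih =>
    rw [← Fin.coeSucc_eq_succ]
    generalize j.castSucc = a at ih
    refine ⟨ih.2, ?_⟩
    have hadj : (cycleGraph (n + 3)).Adj (φ (a + 1)) (φ (a + 1 + 1)) :=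
      φ.map_adj_iff.2 (by simp [cycleGraph_adj])
    rw [ih.2] at hadj
    rcases cycleGraph_adj.1 hadj with h | h
    · have hback : φ (a + 1 + 1) = φ a := by
        rw [ih.1]
        exact (add_right_cancel ((sub_eq_iff_eq_add.1 h).trans (add_comm _ _))).symm
      have := φ.injective hback
      rw [add_assoc, add_eq_left] at this
      exact absurd this.symm n02
    · exact sub_eq_iff_eq_add'.1 h

/-- If every two-coloring of the edges of a cycle is invariant under a reflection, then the
distinguishing index of the cycle is three. -/
theorem distinguishingIndex_cycleGraph_eq_three {n : ℕ}
    (hrefl : ∀ l : Fin (n + 3) → Fin 2, ∃ k, ∀ i, l (k - (i + 1)) = l i) :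
    (cycleGraph (n + 3)).distinguishingIndex = 3 := by
  refine le_antisymm
    (distinguishingIndex_le_of_forall_preservesLabels _
      eq_self_of_preservesLabels_cycleGraphLabeling)
    (le_csInf ⟨3, fun e => cycleGraphLabeling n e, fun φ hφ =>
      eq_self_of_preservesLabels_cycleGraphLabeling φ fun a b hab => hφ ⟨s(a, b), hab⟩⟩ ?_)
  rintro d ⟨f, hf⟩
  exact three_le_of_isDistinguishingEdgeLabeling_cycleGraph hrefl f hf

theorem distinguishingIndex_eq_three_and_maxDegree_eq_two_of_iso_cycleGraph {n : ℕ}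
    [Fintype V] [DecidableRel G.Adj]
    (hrefl : ∀ l : Fin (n + 3) → Fin 2, ∃ k, ∀ i, l (k - (i + 1)) = l i)
    (e : G ≃g cycleGraph (n + 3)) : G.distinguishingIndex = 3 ∧ G.maxDegree = 2 := by
  refine ⟨(distinguishingIndex_eq_of_iso e).trans (distinguishingIndex_cycleGraph_eq_three hrefl),
    e.maxDegree_eq.trans ?_⟩
  exact IsRegularOfDegree.maxDegree_eq (cycleGraph (n + 3)) fun _ => cycleGraph_degree_three_le

theorem Connected.two_le_maxDegree [Fintype V] [DecidableRel G.Adj] (hG : G.Connected)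
    (hn : 3 ≤ Fintype.card V) : 2 ≤ G.maxDegree := by
  classical
  obtain ⟨x⟩ := hG.nonempty
  have : Nontrivial V := Fintype.one_lt_card_iff_nontrivial.1 (by omega)
  obtain ⟨y, hxy⟩ := hG.preconnected.exists_adj_of_nontrivial x
  obtain ⟨v, -, hv⟩ := Finset.exists_mem_notMem_of_card_lt_card
    (s := {x, y}) (t := Finset.univ) (Finset.card_le_two.trans_lt hn)
  obtain ⟨a, ha, b, hb, hab⟩ := hG.exists_adj_mem_notMem (S := {x, y}) (by simp) hv
  obtain ⟨c, hc, hac⟩ : ∃ c ∈ ({x, y} : Finset V), G.Adj a c := by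
    rcases Finset.mem_insert.1 ha with rfl | ha
    · exact ⟨y, by simp, hxy⟩
    · rw [Finset.mem_singleton.1 ha]
      exact ⟨x, by simp, hxy.symm⟩
  refine le_trans ?_ (G.degree_le_maxDegree a)
  rw [← card_neighborFinset_eq_degree, ← Finset.card_pair (fun h : b = c => hb (h ▸ hc))]
  exact Finset.card_le_card (by simp [Finset.insert_subset_iff, hab, hac])

theorem Connected.isRegularOfDegree_of_forall_adj [Fintype V] [DecidableRel G.Adj]
    (hG : G.Connected) (h : ∀ x y, G.Adj x y → G.degree x = G.degree y) :
    G.IsRegularOfDegree G.maxDegree := by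
  classical
  have := hG.nonempty
  obtain ⟨v, hv⟩ := G.exists_maximal_degree_vertex
  intro w
  by_contra hw
  obtain ⟨a, ha, b, hb, hab⟩ := hG.exists_adj_mem_notMem
    (S := {u | G.degree u = G.maxDegree}) ⟨v, by simp [hv]⟩ (v := w) (by simpa using hw)
  simp only [Finset.mem_filter, Finset.mem_univ, true_and] at ha hb
  exact hb ((h a b hab).symm.trans ha)

theorem Connected.distinguishingIndex_le_maxDegree_or_nonempty_iso_cycleGraph [Fintype V]
    [DecidableRel G.Adj] (hG : G.Connected) (hn : 3 ≤ Fintype.card V) :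
    G.distinguishingIndex ≤ G.maxDegree ∨ Nonempty (G ≃g cycleGraph 3) ∨
      Nonempty (G ≃g cycleGraph 4) ∨ Nonempty (G ≃g cycleGraph 5) := by
  obtain ⟨m, hm⟩ := Nat.exists_eq_add_of_le' (hG.two_le_maxDegree hn)
  by_cases h : ∀ x y, G.Adj x y → G.degree x = G.degree y
  · have hreg := hG.isRegularOfDegree_of_forall_adj h
    rw [hm] at hreg ⊢
    cases m with
    | zero => exact hG.distinguishingIndex_le_two_or_nonempty_iso_cycleGraph hreg
    | succ m => exact Or.inl (hG.distinguishingIndex_le_of_isRegularOfDegree hreg)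
  · push Not at h
    obtain ⟨x, y, hxy, hne⟩ := h
    rw [hm]
    exact Or.inl (hG.distinguishingIndex_le_of_degree_ne
      (fun v => (G.degree_le_maxDegree v).trans hm.le) hxy hne)

end SimpleGraph

theorem maxDegree_lt_distinguishingIndex_iff
    {V : Type*} [Fintype V] (G : SimpleGraph V) [DecidableRel G.Adj]
    (hconn : G.Connected) (hn : 3 ≤ Fintype.card V) :
    (G.maxDegree < G.distinguishingIndex ↔
      (Nonempty (G ≃g SimpleGraph.cycleGraph 3) ∨ Nonempty (G ≃g SimpleGraph.cycleGraph 4) ∨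
        Nonempty (G ≃g SimpleGraph.cycleGraph 5))) ∧
    ((Nonempty (G ≃g SimpleGraph.cycleGraph 3) ∨ Nonempty (G ≃g SimpleGraph.cycleGraph 4) ∨
        Nonempty (G ≃g SimpleGraph.cycleGraph 5)) →
      G.distinguishingIndex = G.maxDegree + 1 ∧ G.maxDegree + 1 = 3) := by
  have hcycle : (Nonempty (G ≃g SimpleGraph.cycleGraph 3) ∨
      Nonempty (G ≃g SimpleGraph.cycleGraph 4) ∨ Nonempty (G ≃g SimpleGraph.cycleGraph 5)) →
      G.distinguishingIndex = 3 ∧ G.maxDegree = 2 := by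
    rintro (⟨⟨e⟩⟩ | ⟨⟨e⟩⟩ | ⟨⟨e⟩⟩)
    · exact SimpleGraph.distinguishingIndex_eq_three_and_maxDegree_eq_two_of_iso_cycleGraph
        (n := 0) (by decide) e
    · exact SimpleGraph.distinguishingIndex_eq_three_and_maxDegree_eq_two_of_iso_cycleGraph
        (n := 1) (by decide) e
    · exact SimpleGraph.distinguishingIndex_eq_three_and_maxDegree_eq_two_of_iso_cycleGraph
        (n := 2) (by decide) e
  refine ⟨⟨fun h => ?_, fun h => ?_⟩, fun h => ?_⟩
  · exact (hconn.distinguishingIndex_le_maxDegree_or_nonempty_iso_cycleGraph hn).resolve_left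
      h.not_ge
  · have := hcycle h
    omega
  · have := hcycle h
    omega
end
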